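/- For every n ≥ 2, Shannon entropy μ(x) = −Σ_{i=1}ⁿ x_i log x_i (with the convention 0·log 0 = 0) is antitone with respect to the Bayesian order on Δⁿ: if x ⊑ y then μ(y) ≤ μ(x). -/

import Mathlib

/-- `x` is a classical `n`-state: a point of the simplex
`Δⁿ = {x ∈ [0,1]ⁿ : Σᵢ xᵢ = 1}`. -/
def IsClassicalState (n : ℕ) (x : Fin n → ℝ) : Prop :=
  (∀ i, x i ∈ Set.Icc (0 : ℝ) 1) ∧ ∑ i, x i = 1

/-- The Bayesian projection `pᵢ : Δ^{n+1} ⇀ Δⁿ`: remove coordinate `i` and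
renormalize.  (It is intended to be applied only when `x i ≠ 1`.) -/
noncomputable def bayesProj {n : ℕ} (i : Fin (n + 1)) (x : Fin (n + 1) → ℝ) : Fin n → ℝ :=
  fun j => (1 - x i)⁻¹ * x (i.succAbove j)

/-- The Bayesian order on classical states, defined inductively: on `Δ²`,
`x ⊑ y` iff `(y₁ ≤ x₁ ≤ 1/2)` or `(1/2 ≤ x₁ ≤ y₁)`; on `Δ^{n+1}` (`n ≥ 2`),
`x ⊑ y` iff `pᵢ x ⊑ pᵢ y` whenever both projections are defined. -/
def BayesLE : (n : ℕ) → (Fin n → ℝ) → (Fin n → ℝ) → Prop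
  | 0, _, _ => True
  | 1, _, _ => True
  | 2, x, y => (y 0 ≤ x 0 ∧ x 0 ≤ 1 / 2) ∨ (1 / 2 ≤ x 0 ∧ x 0 ≤ y 0)
  | n + 3, x, y =>
      ∀ i : Fin (n + 3), x i ≠ 1 → y i ≠ 1 →
        BayesLE (n + 2) (bayesProj i x) (bayesProj i y)

/-- Shannon entropy `μ(x) = −Σᵢ xᵢ log xᵢ` (with `0 · log 0 = 0`, as `Real.log 0 = 0`). -/
noncomputable def shannonEntropy (n : ℕ) (x : Fin n → ℝ) : ℝ :=
  -∑ i, x i * Real.log (x i)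

lemma IsClassicalState.nonneg {n : ℕ} {x : Fin n → ℝ} (hx : IsClassicalState n x) (i : Fin n) :
    0 ≤ x i :=
  (hx.1 i).1

lemma IsClassicalState.eq_zero_of_eq_one {n : ℕ} {x : Fin n → ℝ} (hx : IsClassicalState n x)
    {k i : Fin n} (hk : x k = 1) (hik : i ≠ k) : x i = 0 := by
  have h := Finset.add_le_sum (fun j _ => hx.nonneg j) (Finset.mem_univ i) (Finset.mem_univ k) hik
  linarith [hx.2, hx.nonneg i]

lemma IsClassicalState.one_sub_pos {n : ℕ} {x : Fin n → ℝ} (hx : IsClassicalState n x)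
    {k : Fin n} (hk : x k ≠ 1) : 0 < 1 - x k :=
  sub_pos.2 (lt_of_le_of_ne (hx.1 k).2 hk)

/-- Bayesian projection sends classical states in its domain to classical states. -/
lemma IsClassicalState.bayesProj {n : ℕ} {x : Fin (n + 1) → ℝ}
    (hx : IsClassicalState (n + 1) x) {k : Fin (n + 1)} (hk : x k ≠ 1) :
    IsClassicalState n (bayesProj k x) := by
  have hpos := hx.one_sub_pos hk
  have hsum : ∑ j, _root_.bayesProj k x j = 1 := by
    have h := hx.2
    rw [Fin.sum_univ_succAbove _ k] at h
    simp only [_root_.bayesProj, ← Finset.mul_sum]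
    rw [eq_sub_of_add_eq' h]
    exact inv_mul_cancel₀ hpos.ne'
  have hnonneg : ∀ j, 0 ≤ _root_.bayesProj k x j := fun j =>
    mul_nonneg (inv_nonneg.2 hpos.le) (hx.nonneg _)
  refine ⟨fun j => ⟨hnonneg j, ?_⟩, hsum⟩
  exact hsum ▸ Finset.single_le_sum (fun i _ => hnonneg i) (Finset.mem_univ j)

/-- If `x ⊑ y`, then in every pair of coordinates the likelihood ratio `y / x` is ordered in the
same way as `x`. -/
lemma BayesLE.pairwise {n : ℕ} (hn : 2 ≤ n) {x y : Fin n → ℝ}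
    (hx : IsClassicalState n x) (hy : IsClassicalState n y) (h : BayesLE n x y) (i j : Fin n) :
    (x i ≤ x j ∧ y i * x j ≤ x i * y j) ∨ (x j ≤ x i ∧ x i * y j ≤ y i * x j) := by
  induction n, hn using Nat.le_induction with
  | base =>
    have hx1 : x 1 = 1 - x 0 := by have := hx.2; rw [Fin.sum_univ_two] at this; linarith
    have hy1 : y 1 = 1 - y 0 := by have := hy.2; rw [Fin.sum_univ_two] at this; linarith
    have h' : (y 0 ≤ x 0 ∧ x 0 ≤ 1 / 2) ∨ (1 / 2 ≤ x 0 ∧ x 0 ≤ y 0) := h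
    rcases h' with ⟨h₁, h₂⟩ | ⟨h₁, h₂⟩ <;> fin_cases i <;> fin_cases j <;>
      simp only [Fin.zero_eta, Fin.mk_one, hx1, hy1]
    · exact .inl ⟨le_rfl, by linarith⟩
    · exact .inl ⟨by linarith, by linarith⟩
    · exact .inr ⟨by linarith, by linarith⟩
    · exact .inl ⟨le_rfl, by linarith⟩
    · exact .inl ⟨le_rfl, by linarith⟩
    · exact .inr ⟨by linarith, by linarith⟩
    · exact .inl ⟨by linarith, by linarith⟩
    · exact .inl ⟨le_rfl, by linarith⟩
  | succ n hn ih =>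
    obtain ⟨m, rfl⟩ : ∃ m, n = m + 2 := ⟨n - 2, by omega⟩
    obtain ⟨k, hik, hjk⟩ : ∃ k : Fin (m + 2 + 1), i ≠ k ∧ j ≠ k := by
      obtain ⟨k, hk⟩ := Finset.exists_mem_notMem_of_card_lt_card
        (s := {i, j}) (t := (Finset.univ : Finset (Fin (m + 2 + 1))))
        (Finset.card_le_two.trans_lt (by simp))
      simp only [Finset.mem_univ, Finset.mem_insert, Finset.mem_singleton, true_and, not_or] at hk
      exact ⟨k, fun h => hk.1 h.symm, fun h => hk.2 h.symm⟩
    by_cases hxk : x k = 1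
    · simp [hx.eq_zero_of_eq_one hxk hik, hx.eq_zero_of_eq_one hxk hjk]
    by_cases hyk : y k = 1
    · simp [hy.eq_zero_of_eq_one hyk hik, hy.eq_zero_of_eq_one hyk hjk, le_total]
    obtain ⟨i, rfl⟩ := Fin.exists_succAbove_eq hik
    obtain ⟨j, rfl⟩ := Fin.exists_succAbove_eq hjk
    have ha := inv_pos.2 (hx.one_sub_pos hxk)
    have hb := inv_pos.2 (hy.one_sub_pos hyk)
    have key := ih (hx.bayesProj hxk) (hy.bayesProj hyk) (h k hxk hyk) i j
    simp only [bayesProj, mul_le_mul_iff_right₀ ha] at key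
    rw [mul_mul_mul_comm, mul_mul_mul_comm (1 - x k)⁻¹, mul_comm (1 - y k)⁻¹ (1 - x k)⁻¹,
      mul_le_mul_iff_right₀ (mul_pos ha hb), mul_le_mul_iff_right₀ (mul_pos ha hb)] at key
    exact key

/-- Gibbs' inequality, one term at a time. -/
lemma sub_le_mul_log_sub_log {a b : ℝ} (ha : 0 ≤ a) (hb : 0 ≤ b) (hab : a = 0 → b = 0) :
    b - a ≤ b * (Real.log b - Real.log a) := by
  rcases hb.eq_or_lt with rfl | hb
  · simpa using ha
  have ha : 0 < a := lt_of_le_of_ne ha fun h => hb.ne' (hab h.symm)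
  have h := Real.log_le_sub_one_of_pos (div_pos ha hb)
  rw [Real.log_div ha.ne' hb.ne'] at h
  have h' := mul_le_mul_of_nonneg_left h hb.le
  rw [mul_sub, mul_sub, mul_div_cancel₀ _ hb.ne'] at h'
  linarith


/-- For `n ≥ 2`, Shannon entropy is antitone with respect to the Bayesian order
on `Δⁿ`: if `x ⊑ y` then `μ(y) ≤ μ(x)`. -/
theorem shannonEntropy_antitone (n : ℕ) (hn : 2 ≤ n)
    (x y : Fin n → ℝ) (hx : IsClassicalState n x) (hy : IsClassicalState n y)
    (hxy : BayesLE n x y) :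
    shannonEntropy n y ≤ shannonEntropy n x := by
  have pair := hxy.pairwise hn hx hy
  have hac : ∀ i, x i = 0 → y i = 0 := by
    intro i hi
    obtain ⟨j, -, hj⟩ := Finset.exists_ne_zero_of_sum_ne_zero (hx.2.trans_ne one_ne_zero)
    have hj : 0 < x j := lt_of_le_of_ne (hx.nonneg j) hj.symm
    rcases pair i j with ⟨-, h⟩ | ⟨h, -⟩
    · rw [hi, zero_mul] at h
      exact le_antisymm (nonpos_of_mul_nonpos_left h hj) (hy.nonneg i)
    · linarith
  have chebyshev_term : ∀ i j,
      0 ≤ (y i * x j - x i * y j) * (Real.log (x i) - Real.log (x j)) := by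
    intro i j
    rcases (hx.nonneg i).eq_or_lt with hi | hi
    · simp [← hi, hac i hi.symm]
    rcases (hx.nonneg j).eq_or_lt with hj | hj
    · simp [← hj, hac j hj.symm]
    rcases pair i j with ⟨h₁, h₂⟩ | ⟨h₁, h₂⟩
    · exact mul_nonneg_of_nonpos_of_nonpos (sub_nonpos.2 h₂)
        (sub_nonpos.2 (Real.log_le_log hi h₁))
    · exact mul_nonneg (sub_nonneg.2 h₂) (sub_nonneg.2 (Real.log_le_log hj h₁))
  have chebyshev : ∑ i, x i * Real.log (x i) ≤ ∑ i, y i * Real.log (x i) := by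
    have h := Finset.sum_nonneg fun i (_ : i ∈ Finset.univ) =>
      Finset.sum_nonneg fun j (_ : j ∈ Finset.univ) => chebyshev_term i j
    have expand : ∀ i j, (y i * x j - x i * y j) * (Real.log (x i) - Real.log (x j)) =
        y i * Real.log (x i) * x j - x i * Real.log (x i) * y j
          - y i * (x j * Real.log (x j)) + x i * (y j * Real.log (x j)) := by
      intro i j
      ring
    simp only [expand, Finset.sum_add_distrib, Finset.sum_sub_distrib, ← Finset.mul_sum,
      ← Finset.sum_mul, hx.2, hy.2] at h
    linarith
  have gibbs := Finset.sum_le_sum fun i (_ : i ∈ Finset.univ) =>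
    sub_le_mul_log_sub_log (hx.nonneg i) (hy.nonneg i) (hac i)
  simp only [mul_sub, Finset.sum_sub_distrib, hx.2, hy.2] at gibbs
  unfold shannonEntropy
  linarith
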